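/- arXiv:1801.02323 — 11 statements merged into one kernel-verified Lean document; each statement's English description precedes it below -/
import Mathlib

section
/- Let u be a 2×2 matrix over L with rows (a, b) and (c, d) and det u = 1, i.e. u ∈ SL(2, L). Then all four entries of the conjugate matrix k·u·k⁻¹ lie in the subfield K if and only if d = a^q and c = −e·b^q (in which case a^{q+1} + e·b^{q+1} = 1). -/
open Polynomial in
/-- A finite subfield with `q` elements consists of the fixed points of `x ↦ x ^ q`. -/
lemma Subfield.mem_iff_pow_card_eq_self {L : Type*} [Field L] (K : Subfield L) [Fintype K]
    (x : L) : x ∈ K ↔ x ^ Fintype.card K = x := by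
  refine ⟨fun hx => ?_, fun hx => ?_⟩
  · exact congrArg Subtype.val (FiniteField.pow_card (⟨x, hx⟩ : K))
  · classical
    have hone : 1 < Fintype.card K := Fintype.one_lt_card
    have hne : (X ^ Fintype.card K - X : L[X]) ≠ 0 :=
      FiniteField.X_pow_card_sub_X_ne_zero L hone
    have hsub : Finset.univ.image (Subtype.val : K → L) ⊆
        (X ^ Fintype.card K - X : L[X]).roots.toFinset := by
      intro y hy
      obtain ⟨z, -, rfl⟩ := Finset.mem_image.mp hy
      have hz : (z : L) ^ Fintype.card K = z := congrArg Subtype.val (FiniteField.pow_card z)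
      simp [hne, hz]
    have hcard : (X ^ Fintype.card K - X : L[X]).roots.toFinset.card ≤
        (Finset.univ.image (Subtype.val : K → L)).card := by
      rw [Finset.card_image_of_injective _ Subtype.val_injective, Finset.card_univ]
      refine (Multiset.toFinset_card_le _).trans ((card_roots' _).trans ?_)
      rw [FiniteField.X_pow_card_sub_X_natDegree_eq L hone]
    have hmem : x ∈ (X ^ Fintype.card K - X : L[X]).roots.toFinset := by
      simp [hne, hx]
    rw [← Finset.eq_of_subset_of_card_le hsub hcard] at hmem
    obtain ⟨z, -, rfl⟩ := Finset.mem_image.mp hmem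
    exact z.2


/-- Lemma "real": for u ∈ SL(2,L), k·u·k⁻¹ has all entries in the subfield K
iff d = a^q and c = -e·b^q; in which case a^{q+1} + e·b^{q+1} = 1. -/
theorem stmt0 (q : ℕ) (hq : IsPrimePow q) (hodd : Odd q)
    (L : Type) [Field L] (K : Subfield L)
    (hcardL : Nat.card L = q ^ 2) (hcardK : Nat.card K = q)
    (e : L) (heK : e ∈ K) (hns : ¬ ∃ s ∈ K, s ^ 2 = e)
    (et : L) (het : et ^ 2 = e)
    (k : Matrix (Fin 2) (Fin 2) L) (hk : k = !![1, -et⁻¹; et, 1])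
    (u : Matrix (Fin 2) (Fin 2) L) (hu : u.det = 1) :
    ((∀ i j, (k * u * k⁻¹) i j ∈ K) ↔
      (u 1 1 = (u 0 0) ^ q ∧ u 1 0 = -e * (u 0 1) ^ q)) ∧
    ((u 1 1 = (u 0 0) ^ q ∧ u 1 0 = -e * (u 0 1) ^ q) →
      (u 0 0) ^ (q + 1) + e * (u 0 1) ^ (q + 1) = 1) := by
  have : Finite K := Nat.finite_of_card_ne_zero (hcardK ▸ hodd.pos.ne')
  have : Finite L := Nat.finite_of_card_ne_zero (hcardL ▸ (pow_pos hodd.pos 2).ne')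
  have := Fintype.ofFinite K
  have := Fintype.ofFinite L
  have hK : Fintype.card K = q := Nat.card_eq_fintype_card (α := K) ▸ hcardK
  have hL : Fintype.card L = q ^ 2 := Nat.card_eq_fintype_card (α := L) ▸ hcardL
  obtain ⟨φ, hφ⟩ : ∃ φ : L →+* L, ∀ x, φ x = x ^ q :=
    ⟨(FiniteField.frobeniusAlgHom K L).toRingHom, fun x => by simp [hK]⟩
  have hmem (x : L) : x ∈ K ↔ φ x = x := by
    rw [hφ, K.mem_iff_pow_card_eq_self, hK]
  have hinv (x : L) : φ (φ x) = x := by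
    rw [hφ, hφ, ← pow_mul, ← sq, ← hL, FiniteField.pow_card]
  have h2 : (2 : L) ≠ 0 := by
    refine Ring.two_ne_zero fun h => ?_
    have := FiniteField.even_card_of_char_two h
    rw [hL] at this
    exact (Nat.not_even_iff_odd.mpr (hodd.pow (n := 2))) (Nat.even_iff.mpr this)
  have he0 : e ≠ 0 := fun h => hns ⟨0, K.zero_mem, by simp [h]⟩
  have ht0 : et ≠ 0 := fun h => he0 (by simp [← het, h])
  have hφe : φ e = e := (hmem e).mp heK
  have hφt : φ et = -et := by
    have hsq : φ et ^ 2 = et ^ 2 := by rw [← map_pow, het, hφe]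
    exact (sq_eq_sq_iff_eq_or_eq_neg.mp hsq).resolve_left
      fun h => hns ⟨et, (hmem et).mpr h, het⟩
  obtain ⟨a, b, c, d, rfl⟩ : ∃ a b c d, u = !![a, b; c, d] :=
    ⟨_, _, _, _, Matrix.eta_fin_two u⟩
  have hkinv : k⁻¹ = !![2⁻¹, 2⁻¹ * et⁻¹; -(2⁻¹ * et), 2⁻¹] := by
    refine Matrix.inv_eq_right_inv ?_
    rw [hk]
    ext i j
    fin_cases i <;> fin_cases j <;> simp <;> field_simp <;> ring
  have hconj : k * !![a, b; c, d] * k⁻¹ =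
      !![(a + d - (c + e * b) / et) / 2, (et * (a - d) - (c - e * b)) / (2 * e);
        (et * (a - d) + (c - e * b)) / 2, (a + d + (c + e * b) / et) / 2] := by
    rw [hkinv, hk, Matrix.mul_fin_two, Matrix.mul_fin_two, ← het]
    ext i j
    fin_cases i <;> fin_cases j <;> simp <;> field_simp <;> ring
  rw [hconj]
  simp only [Matrix.det_fin_two_of] at hu
  simp only [Fin.forall_fin_two, Matrix.of_apply, Matrix.cons_val', Matrix.cons_val_zero,
    Matrix.cons_val_one, Matrix.cons_val_fin_one, hmem, ← hφ, map_add, map_sub, map_mul, map_div₀,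
    map_ofNat, hφe, hφt]
  refine ⟨⟨?_, ?_⟩, ?_⟩
  · rintro ⟨⟨h₁, h₂⟩, h₃, h₄⟩
    field_simp at h₁ h₂ h₃ h₄
    have hb : (2 * 2 * et) ≠ 0 := by simp [h2, ht0]
    constructor
    · apply mul_left_cancel₀ hb
      linear_combination h₂ + h₃ - h₁ - h₄
    · apply mul_left_cancel₀ hb
      linear_combination et * (h₁ + h₂ - h₃ - h₄)
  · rintro ⟨rfl, rfl⟩
    simp only [map_mul, map_neg, hinv, hφe]
    refine ⟨⟨?_, ?_⟩, ?_, ?_⟩ <;> field_simp <;> ring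
  · rintro ⟨rfl, rfl⟩
    rw [pow_succ, pow_succ, ← hφ, ← hφ]
    linear_combination hu
end

section
/- Let y₁, y₂ ∈ SL(2, F) with traces t₁ and t₂ respectively, and let a ∈ F^× with a ≠ 1 and a ≠ −1. Then y₁·y₂ = a(a) (the diagonal matrix diag(a, a⁻¹)) if and only if there exist y, z ∈ F with y·z = (a + a⁻¹)·t₁·t₂ − t₁² − t₂² − (a − a⁻¹)² such that y₁ = (a − a⁻¹)⁻¹ · [[a·t₁ − t₂, −a·y], [−a⁻¹·z, t₂ − a⁻¹·t₁]] and y₂ = (a − a⁻¹)⁻¹ · [[a·t₂ − t₁, y], [z, t₁ − a⁻¹·t₂]]. -/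
/-- Lemma "multiply" (i): y₁·y₂ = diag(a, a⁻¹) iff y₁, y₂ have the stated form. -/
theorem stmt1 (F : Type) [Field F]
    (y₁ y₂ : Matrix (Fin 2) (Fin 2) F) (h1 : y₁.det = 1) (h2 : y₂.det = 1)
    (t₁ t₂ : F) (ht₁ : t₁ = y₁.trace) (ht₂ : t₂ = y₂.trace)
    (a : F) (ha : a ≠ 0) (ha1 : a ≠ 1) (ha2 : a ≠ -1) :
    y₁ * y₂ = !![a, 0; 0, a⁻¹] ↔
      ∃ y z : F, y * z = (a + a⁻¹) * t₁ * t₂ - t₁ ^ 2 - t₂ ^ 2 - (a - a⁻¹) ^ 2 ∧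
        y₁ = (a - a⁻¹)⁻¹ • !![a * t₁ - t₂, -(a * y); -(a⁻¹ * z), t₂ - a⁻¹ * t₁] ∧
        y₂ = (a - a⁻¹)⁻¹ • !![a * t₂ - t₁, y; z, t₁ - a⁻¹ * t₂] := by
  have hab : a * a⁻¹ = 1 := mul_inv_cancel₀ ha
  have hd : a - a⁻¹ ≠ 0 := by
    intro h
    have h0 : (a - 1) * (a + 1) = 0 := by linear_combination a * h + hab
    rcases mul_eq_zero.mp h0 with h' | h'
    · exact ha1 (sub_eq_zero.mp h')
    · exact ha2 (eq_neg_of_add_eq_zero_left h')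
  have hde : (a - a⁻¹) * (a - a⁻¹)⁻¹ = 1 := mul_inv_cancel₀ hd
  generalize (a - a⁻¹)⁻¹ = e at hde ⊢
  generalize a⁻¹ = b at hab hde hd ⊢
  constructor
  · intro h
    have hy₁ : y₁ = !![a, 0; 0, b] * y₂.adjugate := by
      rw [← h, Matrix.mul_assoc, Matrix.mul_adjugate, h2, one_smul, Matrix.mul_one]
    rw [Matrix.eta_fin_two y₂, Matrix.adjugate_fin_two_of] at hy₁
    rw [Matrix.det_fin_two] at h2
    rw [hy₁, Matrix.trace_fin_two] at ht₁
    rw [Matrix.trace_fin_two] at ht₂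
    simp only [Matrix.mul_fin_two, Matrix.of_apply, Matrix.cons_val', Matrix.cons_val_zero,
      Matrix.cons_val_one, Matrix.cons_val_fin_one] at ht₁ hy₁
    subst ht₁ ht₂
    refine ⟨(a - b) * y₂ 0 1, (a - b) * y₂ 1 0, ?_, ?_, ?_⟩
    · clear h hy₁ h1
      grind only
    · rw [hy₁]
      ext i j
      fin_cases i <;> fin_cases j <;> simp <;> grind only
    · ext i j
      fin_cases i <;> fin_cases j <;> simp <;> grind only
  · rintro ⟨y, z, hyz, rfl, rfl⟩
    ext i j
    fin_cases i <;> fin_cases j <;> simp [Matrix.mul_apply, Fin.sum_univ_two] <;> grind only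
end

section
/- Let y₁, y₂ ∈ SL(2, F) with traces t₁ and t₂ respectively, let μ ∈ {1, −1} and let b ∈ F^×. Then y₁·y₂ = μ·b(b) if and only if there exist x, y ∈ F with x·(t₂ − x) = (t₂ − μ·t₁)·y·b⁻¹ + 1 such that y₁ = [[t₁ − μ·x, μ·(b·x − y)], [(t₁ − μ·t₂)·b⁻¹, μ·x]] and y₂ = [[x, y], [(t₂ − μ·t₁)·b⁻¹, t₂ − x]]. -/
/-- Lemma "multiply" (ii): y₁·y₂ = μ·b(b) iff y₁, y₂ have the stated form. -/
theorem stmt2 (F : Type) [Field F]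
    (y₁ y₂ : Matrix (Fin 2) (Fin 2) F) (h1 : y₁.det = 1) (h2 : y₂.det = 1)
    (t₁ t₂ : F) (ht₁ : t₁ = y₁.trace) (ht₂ : t₂ = y₂.trace)
    (μ : F) (hμ : μ = 1 ∨ μ = -1) (b : F) (hb : b ≠ 0) :
    y₁ * y₂ = μ • !![1, b; 0, 1] ↔
      ∃ x y : F, x * (t₂ - x) = (t₂ - μ * t₁) * y * b⁻¹ + 1 ∧
        y₁ = !![t₁ - μ * x, μ * (b * x - y); (t₁ - μ * t₂) * b⁻¹, μ * x] ∧
        y₂ = !![x, y; (t₂ - μ * t₁) * b⁻¹, t₂ - x] := by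
  have hμ2 : μ * μ = 1 := by rcases hμ with rfl | rfl <;> ring
  have hbc : b * b⁻¹ = 1 := mul_inv_cancel₀ hb
  generalize b⁻¹ = c at *
  constructor
  · intro h
    have e : y₁ = μ • !![1, b; 0, 1] * y₂.adjugate := by
      rw [← h, mul_assoc, Matrix.mul_adjugate, h2, one_smul, mul_one]
    have e00 := congrFun₂ e 0 0
    have e01 := congrFun₂ e 0 1
    have e10 := congrFun₂ e 1 0
    have e11 := congrFun₂ e 1 1
    simp [Matrix.mul_apply, Matrix.adjugate_fin_two] at e00 e01 e10 e11
    rw [Matrix.det_fin_two] at h2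
    rw [Matrix.trace_fin_two] at ht₁ ht₂
    have hr : y₂ 1 0 = (t₂ - μ * t₁) * c := by grind
    refine ⟨y₂ 0 0, y₂ 0 1, by grind, ?_, ?_⟩
    · ext i j
      fin_cases i <;> fin_cases j <;> simp <;> grind
    · ext i j
      fin_cases i <;> fin_cases j <;> simp <;> grind
  · rintro ⟨x, y, h, rfl, rfl⟩
    clear h1 h2 ht₁ ht₂
    ext i j
    fin_cases i <;> fin_cases j <;> simp [Matrix.mul_apply] <;> grind
end

section
/- Let a, a₁, a₂ be units in a field F, and set t = a + a⁻¹, t₁ = a₁ + a₁⁻¹, t₂ = a₂ + a₂⁻¹. Then 4 + t·t₁·t₂ − t² − t₁² − t₂² = 0 if and only if a = a₁^{ε₁}·a₂^{ε₂} for some signs ε₁, ε₂ ∈ {1, −1}. -/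
/-- Δ(t,t₁,t₂) = 0 iff a = a₁^{ε₁}·a₂^{ε₂} for some signs ε₁, ε₂ ∈ {1, −1}. -/
theorem stmt4 (F : Type) [Field F] (a a₁ a₂ : F)
    (ha : a ≠ 0) (ha₁ : a₁ ≠ 0) (ha₂ : a₂ ≠ 0)
    (t t₁ t₂ : F) (ht : t = a + a⁻¹) (ht₁ : t₁ = a₁ + a₁⁻¹) (ht₂ : t₂ = a₂ + a₂⁻¹) :
    4 + t * t₁ * t₂ - t ^ 2 - t₁ ^ 2 - t₂ ^ 2 = 0 ↔
      ∃ ε₁ ε₂ : ℤ, (ε₁ = 1 ∨ ε₁ = -1) ∧ (ε₂ = 1 ∨ ε₂ = -1) ∧ a = a₁ ^ ε₁ * a₂ ^ ε₂ := by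
  have key : 4 + t * t₁ * t₂ - t ^ 2 - t₁ ^ 2 - t₂ ^ 2 =
      -((a - a₁ * a₂) * (a - a₁ * a₂⁻¹) * (a - a₁⁻¹ * a₂) * (a - a₁⁻¹ * a₂⁻¹)) / a ^ 2 := by
    subst ht ht₁ ht₂
    field_simp
    ring
  rw [key, div_eq_zero_iff, or_iff_left (pow_ne_zero 2 ha), neg_eq_zero]
  constructor
  · intro h
    simp only [mul_eq_zero, sub_eq_zero] at h
    rcases h with ((h | h) | h) | h
    · exact ⟨1, 1, by simp, by simp, by simpa using h⟩
    · exact ⟨1, -1, by simp, by simp, by simpa using h⟩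
    · exact ⟨-1, 1, by simp, by simp, by simpa using h⟩
    · exact ⟨-1, -1, by simp, by simp, by simpa only [zpow_neg_one] using h⟩
  · rintro ⟨ε₁, ε₂, rfl | rfl, rfl | rfl, h⟩ <;>
      simp only [zpow_one, zpow_neg_one] at h <;> simp [← h]
end

section
/- Let q be an odd prime power, K a finite field with q elements, and y ∈ K^×. The conjugacy class of b(y) in SL(2, K) equals the set of matrices [[1 − y·a·c, y·a²], [−y·c², 1 + y·a·c]] where (a, c) ranges over K² ∖ {(0,0)}. -/
/-- The conjugate of an upper unitriangular matrix by a matrix of determinant one depends only on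
the first column of the latter. -/
theorem conj_upper_unitriangular {R : Type*} [CommRing R] {a b c d : R}
    (h : a * d - b * c = 1) (y : R) :
    !![a, b; c, d] * !![1, y; 0, 1] * !![a, b; c, d]⁻¹ =
      !![1 - y * a * c, y * a ^ 2; -(y * c ^ 2), 1 + y * a * c] := by
  have hinv : !![a, b; c, d]⁻¹ = !![d, -b; -c, a] := by
    rw [Matrix.inv_def, Matrix.det_fin_two_of, h, Ring.inverse_one, one_smul,
      Matrix.adjugate_fin_two_of]
  rw [hinv, Matrix.mul_fin_two, Matrix.mul_fin_two]
  ext i j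
  fin_cases i <;> fin_cases j <;> simp
  · linear_combination h
  · ring
  · ring
  · linear_combination h

/-- A nonzero vector of `K²` is the first column of a matrix of determinant one. -/
theorem exists_det_eq_one_of_ne_zero {K : Type*} [Field K] {a c : K} (h : (a, c) ≠ (0, 0)) :
    ∃ b d : K, a * d - b * c = 1 := by
  by_cases ha : a = 0
  · have hc : c ≠ 0 := fun hc => h (by rw [ha, hc])
    exact ⟨-c⁻¹, 0, by field_simp; ring⟩
  · exact ⟨0, a⁻¹, by field_simp; ring⟩

/-- The conjugacy class of b(y) in SL(2,K). -/
theorem stmt8 (q : ℕ) (hq : IsPrimePow q) (hodd : Odd q)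
    (K : Type) [Field K] (hcard : Nat.card K = q) (y : K) (hy : y ≠ 0) :
    {m : Matrix (Fin 2) (Fin 2) K |
        ∃ h : Matrix (Fin 2) (Fin 2) K, h.det = 1 ∧ m = h * !![1, y; 0, 1] * h⁻¹} =
      {m : Matrix (Fin 2) (Fin 2) K |
        ∃ a c : K, (a, c) ≠ (0, 0) ∧
          m = !![1 - y * a * c, y * a ^ 2; -(y * c ^ 2), 1 + y * a * c]} := by
  ext m
  constructor
  · rintro ⟨h, hdet, rfl⟩
    rw [Matrix.det_fin_two] at hdet
    refine ⟨h 0 0, h 1 0, fun h0 => ?_, ?_⟩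
    · obtain ⟨h₀, h₁⟩ := Prod.mk.inj h0
      simp [h₀, h₁] at hdet
    · rw [← conj_upper_unitriangular hdet y, ← Matrix.eta_fin_two h]
  · rintro ⟨a, c, hac, rfl⟩
    obtain ⟨b, d, hdet⟩ := exists_det_eq_one_of_ne_zero hac
    exact ⟨!![a, b; c, d], by rw [Matrix.det_fin_two_of, hdet],
      (conj_upper_unitriangular hdet y).symm⟩
end

section
/- Let q be an odd prime power and K a finite field with q elements. If x ∈ SL(2, K) is not a scalar matrix (equivalently, x is not in the center {1, −1} of SL(2, K)), then the centralizer of x in SL(2, K) is a commutative group. -/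
/-- Two `2 × 2` matrices over a field commute as soon as both commute with a matrix that is
not scalar. -/
theorem Matrix.mul_comm_of_commute_nonscalar {K : Type*} [Field K]
    {x g h : Matrix (Fin 2) (Fin 2) K}
    (hx : x 0 1 ≠ 0 ∨ x 1 0 ≠ 0 ∨ x 0 0 - x 1 1 ≠ 0)
    (hg : g * x = x * g) (hh : h * x = x * h) : g * h = h * g := by
  have entries {y z : Matrix (Fin 2) (Fin 2) K} : y * z = z * y ↔
      y 0 1 * z 1 0 = z 0 1 * y 1 0 ∧
      (y 0 0 - y 1 1) * z 0 1 = y 0 1 * (z 0 0 - z 1 1) ∧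
      (y 0 0 - y 1 1) * z 1 0 = y 1 0 * (z 0 0 - z 1 1) := by
    constructor
    · intro e
      have e00 := congrFun (congrFun e 0) 0
      have e01 := congrFun (congrFun e 0) 1
      have e10 := congrFun (congrFun e 1) 0
      simp only [Matrix.mul_apply, Fin.sum_univ_two] at e00 e01 e10
      refine ⟨?_, ?_, ?_⟩
      · linear_combination e00
      · linear_combination e01
      · linear_combination -e10
    · rintro ⟨e₁, e₂, e₃⟩
      ext i j
      fin_cases i <;> fin_cases j <;>
        simp only [Matrix.mul_apply, Fin.sum_univ_two, Fin.zero_eta, Fin.mk_one]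
      · linear_combination e₁
      · linear_combination e₂
      · linear_combination -e₃
      · linear_combination -e₁
  rw [entries] at hg hh ⊢
  obtain ⟨g₁, g₂, g₃⟩ := hg
  obtain ⟨h₁, h₂, h₃⟩ := hh
  rcases hx with hx | hx | hx <;>
    refine ⟨mul_left_cancel₀ hx ?_, mul_left_cancel₀ hx ?_, mul_left_cancel₀ hx ?_⟩ <;> grind

/-- The centralizer of a non-central element of SL(2,K) is commutative. -/
theorem stmt9 (q : ℕ) (hq : IsPrimePow q) (hodd : Odd q)
    (K : Type) [Field K] (hcard : Nat.card K = q)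
    (x : Matrix (Fin 2) (Fin 2) K) (hx : x.det = 1) (hx1 : x ≠ 1) (hx2 : x ≠ -1) :
    ∀ g h : Matrix (Fin 2) (Fin 2) K, g.det = 1 → h.det = 1 →
      g * x = x * g → h * x = x * h → g * h = h * g := by
  intro g h _ _ hg hh
  refine Matrix.mul_comm_of_commute_nonscalar ?_ hg hh
  by_contra! hscalar
  obtain ⟨hb, hc, had⟩ := hscalar
  have hd : x 1 1 = x 0 0 := (sub_eq_zero.mp had).symm
  rw [Matrix.det_fin_two, hb, hd, zero_mul, sub_zero] at hx
  rcases mul_self_eq_one_iff.mp hx with ha | ha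
  · apply hx1
    ext i j
    fin_cases i <;> fin_cases j <;> simp [hb, hc, hd, ha]
  · apply hx2
    ext i j
    fin_cases i <;> fin_cases j <;> simp [hb, hc, hd, ha]
end

section
/- Let q be a prime power with q ≡ 1 (mod 4) and K a finite field with q elements. Then every element of SL(2, K) is conjugate in SL(2, K) to its inverse. -/
/-- A traceless `g = !![p, r; s, -p]` of determinant one such that `g * x` is traceless
conjugates `x` to `x⁻¹`. -/
theorem Matrix.SpecialLinearGroup.isConj_inv_of_traceless {R : Type*} [CommRing R]
    (x : Matrix.SpecialLinearGroup (Fin 2) R) (p r s : R) (hdet : p ^ 2 + r * s = -1)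
    (htr : p * (x 0 0 - x 1 1) + r * x 1 0 + s * x 0 1 = 0) : IsConj x x⁻¹ := by
  obtain ⟨g, hg⟩ : ∃ g : Matrix.SpecialLinearGroup (Fin 2) R,
      (g : Matrix (Fin 2) (Fin 2) R) = !![p, r; s, -p] := by
    refine ⟨⟨!![p, r; s, -p], ?_⟩, rfl⟩
    rw [Matrix.det_fin_two_of]
    linear_combination -hdet
  rw [isConj_iff]
  refine ⟨g, ?_⟩
  rw [mul_inv_eq_iff_eq_mul]
  ext i j
  fin_cases i <;> fin_cases j <;>
    simp [hg, Matrix.adjugate_fin_two, Matrix.mul_apply, Fin.sum_univ_two]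
  · linear_combination htr
  · ring
  · ring
  · linear_combination htr

/-- Over a field in which `-1` is a square, every element of `SL(2, K)` is conjugate to its
inverse. -/
theorem Matrix.SpecialLinearGroup.isConj_inv_of_isSquare_neg_one {K : Type*} [Field K]
    (h : IsSquare (-1 : K)) (x : Matrix.SpecialLinearGroup (Fin 2) K) : IsConj x x⁻¹ := by
  obtain ⟨i, hi⟩ := h
  by_cases hb : x 0 1 = 0
  · by_cases hc : x 1 0 = 0
    · exact x.isConj_inv_of_traceless 0 1 (-1) (by ring) (by simp [hb, hc])
    · refine x.isConj_inv_of_traceless i (-(i * (x 0 0 - x 1 1)) / x 1 0) 0 ?_ ?_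
      · linear_combination -hi
      · field_simp
        ring
  · refine x.isConj_inv_of_traceless i 0 (-(i * (x 0 0 - x 1 1)) / x 0 1) ?_ ?_
    · linear_combination -hi
    · field_simp
      ring

/-- If q ≡ 1 (mod 4), every element of SL(2,K) is conjugate to its inverse. -/
theorem stmt10 (q : ℕ) (hq : IsPrimePow q) (h4 : q % 4 = 1)
    (K : Type) [Field K] (hcard : Nat.card K = q) :
    ∀ x : Matrix.SpecialLinearGroup (Fin 2) K, IsConj x x⁻¹ := by
  have : Finite K := Nat.finite_of_card_ne_zero (hcard ▸ hq.ne_zero)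
  have : Fintype K := Fintype.ofFinite K
  refine Matrix.SpecialLinearGroup.isConj_inv_of_isSquare_neg_one ?_
  rw [FiniteField.isSquare_neg_one_iff, ← Nat.card_eq_fintype_card, hcard, h4]
  decide
end

section
/- Let q be an odd prime power, K a finite field with q elements, and y ∈ K^×. The centralizer of b(y) in SL(2, K) equals {ε·b(c) : ε ∈ {1, −1}, c ∈ K} and has exactly 2q elements; consequently the conjugacy class of b(y) in SL(2, K) has exactly (q² − 1)/2 elements. -/
/-- In a finite field of odd cardinality, `-1 ≠ 1`. -/
theorem neg_one_ne_one_of_odd_natCard {K : Type*} [Field K] [Finite K] (h : Odd (Nat.card K)) :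
    (-1 : K) ≠ 1 := by
  have := Fintype.ofFinite K
  have hK : ringChar K ≠ 2 := fun h2 => by
    have := FiniteField.even_card_of_char_two h2
    rw [Nat.card_eq_fintype_card, Nat.odd_iff] at h
    omega
  exact Ring.neg_one_ne_one_of_char_ne_two hK

theorem centralizer_upper_unitriangular {K : Type*} [Field K] {y : K} (hy : y ≠ 0) :
    {g : Matrix (Fin 2) (Fin 2) K | g.det = 1 ∧ g * !![1, y; 0, 1] = !![1, y; 0, 1] * g} =
      {g : Matrix (Fin 2) (Fin 2) K |
        ∃ ε c : K, (ε = 1 ∨ ε = -1) ∧ g = ε • !![1, c; 0, 1]} := by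
  ext g
  constructor
  · rintro ⟨hdet, hcomm⟩
    have h00 := congrFun (congrFun hcomm 0) 0
    have h01 := congrFun (congrFun hcomm 0) 1
    simp only [Matrix.mul_apply, Fin.sum_univ_two, Matrix.of_apply, Matrix.cons_val',
      Matrix.cons_val_zero, Matrix.cons_val_one, Matrix.cons_val_fin_one] at h00 h01
    have hc : g 1 0 = 0 := by
      have : y * g 1 0 = 0 := by linear_combination -h00
      simpa [hy] using this
    have hd : g 0 0 = g 1 1 := by
      apply mul_left_cancel₀ hy
      linear_combination h01
    rw [Matrix.det_fin_two, hc, ← hd] at hdet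
    have hsq : g 0 0 * g 0 0 = 1 := by linear_combination hdet
    refine ⟨g 0 0, g 0 0 * g 0 1, mul_self_eq_one_iff.mp hsq, ?_⟩
    ext i j
    fin_cases i <;> fin_cases j
    · simp
    · simp [← mul_assoc, hsq]
    · simp [hc]
    · simp [hd]
  · rintro ⟨ε, c, hε, rfl⟩
    refine ⟨?_, ?_⟩
    · rcases hε with rfl | rfl <;> simp [Matrix.det_fin_two]
    · ext i j
      fin_cases i <;> fin_cases j <;>
        simp [Matrix.mul_apply, Fin.sum_univ_two, add_comm, mul_comm]

theorem natCard_signed_upper_unitriangular {K : Type*} [Field K] [Finite K]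
    (hodd : Odd (Nat.card K)) :
    Nat.card {g : Matrix (Fin 2) (Fin 2) K |
        ∃ ε c : K, (ε = 1 ∨ ε = -1) ∧ g = ε • !![1, c; 0, 1]} = 2 * Nat.card K := by
  have himage : {g : Matrix (Fin 2) (Fin 2) K |
      ∃ ε c : K, (ε = 1 ∨ ε = -1) ∧ g = ε • !![1, c; 0, 1]} =
      (fun p : K × K => p.1 • !![1, p.2; 0, 1]) '' (({1, -1} : Set K) ×ˢ Set.univ) := by
    ext g
    simp [eq_comm]
  have hinj : Set.InjOn (fun p : K × K => p.1 • !![1, p.2; 0, 1])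
      (({1, -1} : Set K) ×ˢ Set.univ) := by
    rintro ⟨ε, c⟩ ⟨hε, -⟩ ⟨δ, d⟩ - h
    have h00 : ε = δ := by simpa using congrFun (congrFun h 0) 0
    subst h00
    have hε0 : ε ≠ 0 := by
      rcases hε with h | h <;> simp_all
    have h01 : c = d := by simpa [hε0] using congrFun (congrFun h 0) 1
    rw [h01]
  rw [himage, Nat.card_coe_set_eq, hinj.ncard_image, Set.ncard_prod,
    Set.ncard_pair (neg_one_ne_one_of_odd_natCard hodd).symm, Set.ncard_univ]

/-- The conjugate of the upper unitriangular matrix with corner entry `y` by a matrix of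
determinant one whose first column is `v`. -/
def unipotentOfColumn {K : Type*} [Field K] (y : K) (v : K × K) : Matrix (Fin 2) (Fin 2) K :=
  !![1 - y * v.1 * v.2, y * v.1 ^ 2; -(y * v.2 ^ 2), 1 + y * v.1 * v.2]

theorem conj_eq_unipotentOfColumn {K : Type*} [Field K] (y : K) {g : Matrix (Fin 2) (Fin 2) K}
    (hg : g.det = 1) :
    g * !![1, y; 0, 1] * g⁻¹ = unipotentOfColumn y (g 0 0, g 1 0) := by
  have hdet := hg
  rw [Matrix.det_fin_two] at hdet
  rw [Matrix.inv_def, hg, Matrix.adjugate_fin_two]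
  ext i j
  fin_cases i <;> fin_cases j <;>
    simp [Matrix.mul_apply, Fin.sum_univ_two, unipotentOfColumn]
  · linear_combination hdet
  · ring
  · ring
  · linear_combination hdet

theorem conjugates_eq_image_unipotentOfColumn {K : Type*} [Field K] (y : K) :
    {m : Matrix (Fin 2) (Fin 2) K |
        ∃ g : Matrix (Fin 2) (Fin 2) K, g.det = 1 ∧ m = g * !![1, y; 0, 1] * g⁻¹} =
      unipotentOfColumn y '' {0}ᶜ := by
  ext m
  constructor
  · rintro ⟨g, hg, rfl⟩
    refine ⟨(g 0 0, g 1 0), fun h => ?_, (conj_eq_unipotentOfColumn y hg).symm⟩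
    obtain ⟨ha, hc⟩ := Prod.mk.inj h
    simp [Matrix.det_fin_two, ha, hc] at hg
  · rintro ⟨⟨a, c⟩, hv, rfl⟩
    obtain ⟨b, d, hdet⟩ : ∃ b d : K, a * d - b * c = 1 := by
      by_cases ha : a = 0
      · have hc : c ≠ 0 := fun hc => hv (by simp [ha, hc])
        exact ⟨-c⁻¹, 0, by simp [hc]⟩
      · exact ⟨0, a⁻¹, by simp [ha]⟩
    have hg : (!![a, b; c, d] : Matrix (Fin 2) (Fin 2) K).det = 1 := by
      rw [Matrix.det_fin_two_of, hdet]
    exact ⟨!![a, b; c, d], hg, (conj_eq_unipotentOfColumn y hg).symm⟩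

theorem unipotentOfColumn_eq_iff {K : Type*} [Field K] {y : K} (hy : y ≠ 0) (v w : K × K) :
    unipotentOfColumn y v = unipotentOfColumn y w ↔ v = w ∨ v = -w := by
  obtain ⟨a, c⟩ := v
  obtain ⟨b, d⟩ := w
  constructor
  · intro h
    have h00 : a * c = b * d := by
      simpa [unipotentOfColumn, mul_assoc, hy] using congrFun (congrFun h 0) 0
    have h01 : a ^ 2 = b ^ 2 := by
      simpa [unipotentOfColumn, hy] using congrFun (congrFun h 0) 1
    have h10 : c ^ 2 = d ^ 2 := by
      simpa [unipotentOfColumn, hy] using congrFun (congrFun h 1) 0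
    simp only [Prod.mk.injEq, Prod.neg_mk]
    by_cases hb : b = 0
    · have ha : a = 0 := by simpa [hb] using h01
      simpa [ha, hb] using sq_eq_sq_iff_eq_or_eq_neg.mp h10
    · rcases sq_eq_sq_iff_eq_or_eq_neg.mp h01 with rfl | rfl
      · exact Or.inl ⟨rfl, mul_left_cancel₀ hb h00⟩
      · exact Or.inr ⟨rfl, mul_left_cancel₀ hb (by linear_combination -h00)⟩
  · rintro (h | h) <;> rw [h]
    simp [unipotentOfColumn]

theorem natCard_image_unipotentOfColumn {K : Type*} [Field K] [Finite K]
    (hodd : Odd (Nat.card K)) {y : K} (hy : y ≠ 0) :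
    2 * Nat.card (unipotentOfColumn y '' {0}ᶜ) = Nat.card K ^ 2 - 1 := by
  classical
  have := Fintype.ofFinite K
  have hfiber : ∀ m ∈ (Finset.univ.erase (0 : K × K)).image (unipotentOfColumn y),
      ((Finset.univ.erase (0 : K × K)).filter (unipotentOfColumn y · = m)).card = 2 := by
    intro m hm
    obtain ⟨v, hv, rfl⟩ := Finset.mem_image.mp hm
    have hv0 : v ≠ 0 := Finset.ne_of_mem_erase hv
    have hneg : v ≠ -v := by
      have h1 : ∀ x : K, x = -x → x = 0 := fun x hx => by
        by_contra h0
        exact neg_one_ne_one_of_odd_natCard hodd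
          (mul_right_cancel₀ h0 (by linear_combination -hx))
      exact fun h => hv0 (Prod.ext (h1 _ (congrArg Prod.fst h)) (h1 _ (congrArg Prod.snd h)))
    refine Eq.trans (congrArg Finset.card ?_) (Finset.card_pair hneg)
    ext w
    simp only [Finset.mem_filter, Finset.mem_erase, Finset.mem_univ, and_true,
      unipotentOfColumn_eq_iff hy, Finset.mem_insert, Finset.mem_singleton]
    refine ⟨And.right, fun h => ⟨?_, h⟩⟩
    rcases h with rfl | rfl
    · exact hv0
    · exact neg_ne_zero.mpr hv0
  have hsum := Finset.card_eq_sum_card_image (unipotentOfColumn y)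
    (Finset.univ.erase (0 : K × K))
  rw [Finset.sum_congr rfl hfiber, Finset.sum_const, smul_eq_mul,
    Finset.card_erase_of_mem (Finset.mem_univ _), Finset.card_univ, Fintype.card_prod,
    ← Nat.card_eq_fintype_card, ← sq, mul_comm] at hsum
  have himage : unipotentOfColumn y '' {0}ᶜ =
      ((Finset.univ.erase (0 : K × K)).image (unipotentOfColumn y) : Set _) := by
    ext m
    simp
  rw [hsum, himage, Nat.card_coe_set_eq, Set.ncard_coe_finset]

/-- The centralizer of b(y) in SL(2,K) is {ε·b(c)}, of cardinality 2q; hence the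
conjugacy class of b(y) has (q²−1)/2 elements. -/
theorem stmt12 (q : ℕ) (hq : IsPrimePow q) (hodd : Odd q)
    (K : Type) [Field K] (hcard : Nat.card K = q) (y : K) (hy : y ≠ 0) :
    {g : Matrix (Fin 2) (Fin 2) K | g.det = 1 ∧ g * !![1, y; 0, 1] = !![1, y; 0, 1] * g} =
      {g : Matrix (Fin 2) (Fin 2) K |
        ∃ ε c : K, (ε = 1 ∨ ε = -1) ∧ g = ε • !![1, c; 0, 1]} ∧
    Nat.card {g : Matrix (Fin 2) (Fin 2) K |
        g.det = 1 ∧ g * !![1, y; 0, 1] = !![1, y; 0, 1] * g} = 2 * q ∧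
    Nat.card {m : Matrix (Fin 2) (Fin 2) K |
        ∃ g : Matrix (Fin 2) (Fin 2) K, g.det = 1 ∧ m = g * !![1, y; 0, 1] * g⁻¹} =
      (q ^ 2 - 1) / 2 := by
  subst hcard
  have : Finite K := Nat.finite_of_card_ne_zero hq.ne_zero
  refine ⟨centralizer_upper_unitriangular hy, ?_, ?_⟩
  · rw [centralizer_upper_unitriangular hy, natCard_signed_upper_unitriangular hodd]
  · rw [conjugates_eq_image_unipotentOfColumn, ← natCard_image_unipotentOfColumn hodd hy,
      Nat.mul_div_cancel_left _ two_pos]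
end

section
/- Let x ∈ L^× with x^{q+1} = 1, x ≠ 1 and x ≠ −1, and let m = k·a(x)·k⁻¹, which is a matrix with entries in K of determinant 1. Then the centralizer of m in SL(2, K) equals {k·a(z)·k⁻¹ : z ∈ L^×, z^{q+1} = 1} and has exactly q + 1 elements; consequently the conjugacy class of m in SL(2, K) has exactly q·(q − 1) elements. -/
namespace NonsplitTorus

open Matrix

theorem nat_card_SL_two (F : Type*) [Field F] [Finite F] :
    Nat.card (SpecialLinearGroup (Fin 2) F) =
      Nat.card F * (Nat.card F - 1) * (Nat.card F + 1) := by
  have := Fintype.ofFinite F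
  let d : GL (Fin 2) F →* Fˣ := GeneralLinearGroup.det
  have hd : Function.Surjective d := GeneralLinearGroup.det_surjective
  have hker : Nat.card (SpecialLinearGroup (Fin 2) F) = Nat.card d.ker := by
    refine Nat.card_eq_of_bijective
      (fun g => (⟨g.toGL, SpecialLinearGroup.coeToGL_det g⟩ : d.ker)) ⟨fun g h hgh => ?_, ?_⟩
    · exact SpecialLinearGroup.toGL_injective (congrArg Subtype.val hgh)
    · rintro ⟨g, hg⟩
      refine ⟨⟨g.val, congrArg Units.val hg⟩, ?_⟩
      ext : 2
      rfl
  have hindex : d.ker.index = Nat.card F - 1 := by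
    rw [Subgroup.index_ker, MonoidHom.range_eq_top.2 hd, Subgroup.card_top, Nat.card_units]
  have hmul := d.ker.card_mul_index
  rw [← hker, hindex, card_GL_field, ← Nat.card_eq_fintype_card, Fin.prod_univ_two] at hmul
  have h1 : 1 < Nat.card F := Finite.one_lt_card
  obtain ⟨n, hn⟩ : ∃ n, Nat.card F = n + 2 := ⟨Nat.card F - 2, by omega⟩
  rw [hn] at hmul ⊢
  have e1 : (n + 2) ^ 2 - (n + 2) ^ ((0 : Fin 2) : ℕ) = (n + 1) * (n + 3) := by
    simp only [Fin.val_zero, pow_zero]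
    exact Nat.sub_eq_of_eq_add (by ring)
  have e2 : (n + 2) ^ 2 - (n + 2) ^ ((1 : Fin 2) : ℕ) = (n + 2) * (n + 1) := by
    simp only [Fin.val_one, pow_one]
    exact Nat.sub_eq_of_eq_add (by ring)
  rw [e1, e2] at hmul
  simp only [Nat.add_succ_sub_one] at hmul ⊢
  refine Nat.eq_of_mul_eq_mul_right (Nat.succ_pos n) ?_
  rw [Nat.succ_eq_add_one, hmul]
  ring

/-- Orbit-stabilizer for conjugation by `SL(2, K)`, in terms of matrices over the big field. -/
theorem nat_card_conjugates_mul_nat_card_centralizer {L : Type*} [Field L] [Finite L]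
    (K : Subfield L) (m : Matrix (Fin 2) (Fin 2) L) (hm : ∀ i j, m i j ∈ K) (hdet : m.det = 1) :
    Nat.card {n : Matrix (Fin 2) (Fin 2) L |
        ∃ g : Matrix (Fin 2) (Fin 2) L, (∀ i j, g i j ∈ K) ∧ g.det = 1 ∧ n = g * m * g⁻¹} *
      Nat.card {g : Matrix (Fin 2) (Fin 2) L |
        (∀ i j, g i j ∈ K) ∧ g.det = 1 ∧ g * m = m * g} =
      Nat.card (SpecialLinearGroup (Fin 2) K) := by
  let φ : SpecialLinearGroup (Fin 2) K →* Matrix (Fin 2) (Fin 2) L :=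
    (K.subtype.mapMatrix (m := Fin 2)).toMonoidHom.comp
      SpecialLinearGroup.coeMonoidHom
  have hφ : Function.Injective φ := fun g h hgh => by
    ext i j
    exact congrFun (congrFun hgh i) j
  have hφ_mem (g) : (∀ i j, φ g i j ∈ K) ∧ (φ g).det = 1 := by
    refine ⟨fun i j => (g.1 i j).2, ?_⟩
    change (K.subtype.mapMatrix g.1).det = 1
    rw [← RingHom.map_det, g.2, map_one]
  have hφ_surj (g : Matrix (Fin 2) (Fin 2) L) (hg : ∀ i j, g i j ∈ K) (hg1 : g.det = 1) :
      ∃ h, φ h = g := by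
    refine ⟨⟨Matrix.of fun i j => ⟨g i j, hg i j⟩, ?_⟩, ?_⟩
    · apply K.subtype.injective
      rw [RingHom.map_det, map_one, ← hg1]
      rfl
    · rfl
  have hφ_inv (g) : φ g⁻¹ = (φ g)⁻¹ :=
    (Matrix.inv_eq_right_inv (by rw [← map_mul, mul_inv_cancel, map_one])).symm
  obtain ⟨M, rfl⟩ := hφ_surj m hm hdet
  have hconj : {n : Matrix (Fin 2) (Fin 2) L |
      ∃ g : Matrix (Fin 2) (Fin 2) L, (∀ i j, g i j ∈ K) ∧ g.det = 1 ∧ n = g * φ M * g⁻¹} =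
      φ '' MulAction.orbit (ConjAct (SpecialLinearGroup (Fin 2) K)) M := by
    ext n
    constructor
    · rintro ⟨g, hg, hg1, rfl⟩
      obtain ⟨h, rfl⟩ := hφ_surj g hg hg1
      refine ⟨h * M * h⁻¹, ⟨ConjAct.toConjAct h, ConjAct.toConjAct_smul h M⟩, ?_⟩
      rw [map_mul, map_mul, hφ_inv]
    · rintro ⟨_, ⟨h, rfl⟩, rfl⟩
      refine ⟨φ (ConjAct.ofConjAct h), (hφ_mem _).1, (hφ_mem _).2, ?_⟩
      rw [← hφ_inv, ← map_mul, ← map_mul]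
      rfl
  have hcent : {g : Matrix (Fin 2) (Fin 2) L |
      (∀ i j, g i j ∈ K) ∧ g.det = 1 ∧ g * φ M = φ M * g} =
      φ '' (Subgroup.centralizer {M} : Set (SpecialLinearGroup (Fin 2) K)) := by
    ext g
    constructor
    · rintro ⟨hg, hg1, hc⟩
      obtain ⟨h, rfl⟩ := hφ_surj g hg hg1
      refine ⟨h, Subgroup.mem_centralizer_singleton_iff.2 (hφ ?_), rfl⟩
      simpa only [map_mul] using hc
    · rintro ⟨h, hh, rfl⟩
      refine ⟨(hφ_mem _).1, (hφ_mem _).2, ?_⟩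
      rw [← map_mul, ← map_mul, Subgroup.mem_centralizer_singleton_iff.1 hh]
  rw [hconj, hcent, Nat.card_image_of_injective hφ, Nat.card_image_of_injective hφ,
    show Nat.card (Subgroup.centralizer {M} : Set (SpecialLinearGroup (Fin 2) K)) =
      Nat.card (MulAction.stabilizer (ConjAct (SpecialLinearGroup (Fin 2) K)) M) from
      Subgroup.nat_card_centralizer_nat_card_stabilizer M, ← Nat.card_prod]
  exact Nat.card_congr
    (MulAction.orbitProdStabilizerEquivGroup (ConjAct (SpecialLinearGroup (Fin 2) K)) M)

theorem mem_subfield_iff_pow_card_eq {L : Type*} [Field L] [Finite L] (K : Subfield L) {y : L} :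
    y ∈ K ↔ y ^ Nat.card K = y := by
  have := Fintype.ofFinite K
  rw [Nat.card_eq_fintype_card]
  constructor
  · intro hy
    exact congrArg Subtype.val (FiniteField.pow_card (⟨y, hy⟩ : K))
  · intro hy
    have hroots := FiniteField.roots_X_pow_card_sub_X K
    have h1 : 1 < Fintype.card K := Fintype.one_lt_card
    have hs : ((Polynomial.X ^ Fintype.card K - Polynomial.X : Polynomial K)).Splits := by
      rw [Polynomial.splits_iff_card_roots, hroots, FiniteField.X_pow_card_sub_X_natDegree_eq K h1]
      rfl
    have h0 := FiniteField.X_pow_card_sub_X_ne_zero K h1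
    obtain ⟨z, hz⟩ := hs.mem_range_of_isRoot h0 (i := algebraMap K L) (x := y) (by simp [hy])
    exact hz ▸ z.2

theorem nat_card_norm_one {L : Type*} [Field L] [Finite L] {q : ℕ} (h : Nat.card L = q ^ 2) :
    Nat.card {z : L | z ^ (q + 1) = 1} = q + 1 := by
  have hq : 1 < q := by
    have : 1 < Nat.card L := Finite.one_lt_card
    by_contra! hq
    interval_cases q <;> omega
  have hker := IsCyclic.card_powMonoidHom_ker (G := Lˣ) (q + 1)
  have hgcd : (Nat.card Lˣ).gcd (q + 1) = q + 1 := by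
    rw [Nat.card_units, h]
    exact Nat.gcd_eq_right ⟨q - 1, by simpa using Nat.sq_sub_sq q 1⟩
  rw [hgcd] at hker
  refine Eq.trans (Eq.symm ?_) hker
  refine Nat.card_eq_of_bijective (fun u => ⟨(u.1 : L), ?_⟩) ⟨fun u v huv => ?_, ?_⟩
  · exact congrArg Units.val u.2
  · exact Subtype.ext (Units.ext (congrArg Subtype.val huv))
  · rintro ⟨z, hz⟩
    have hz0 : z ≠ 0 := by
      rintro rfl
      simp at hz
    exact ⟨⟨Units.mk0 z hz0, Units.ext hz⟩, rfl⟩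

theorem conj_diag_eq {L : Type*} [Field L] {t : L} (ht : t ≠ 0) (h2 : (2 : L) ≠ 0) (z : L) :
    !![1, -t⁻¹; t, 1] * !![z, 0; 0, z⁻¹] * !![1, -t⁻¹; t, 1]⁻¹ =
      !![(z + z⁻¹) / 2, (z - z⁻¹) / (2 * t); t * (z - z⁻¹) / 2, (z + z⁻¹) / 2] := by
  have hk : !![1, -t⁻¹; t, 1]⁻¹ = !![1 / 2, 1 / (2 * t); -t / 2, 1 / 2] := by
    refine Matrix.inv_eq_right_inv ?_
    ext i j
    fin_cases i <;> fin_cases j <;> simp <;> field_simp <;> ring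
  rw [hk]
  generalize z⁻¹ = w
  ext i j
  fin_cases i <;> fin_cases j <;> simp <;> field_simp <;> ring

theorem eq_of_commute_of_entries {L : Type*} [Field L] {a b c : L} (hb : b ≠ 0)
    {g : Matrix (Fin 2) (Fin 2) L}
    (hg : g * !![a, b; c * b, a] = !![a, b; c * b, a] * g) :
    g 1 1 = g 0 0 ∧ g 1 0 = c * g 0 1 := by
  have h00 := congrFun (congrFun hg 0) 0
  have h01 := congrFun (congrFun hg 0) 1
  simp only [Matrix.mul_apply, Fin.sum_univ_two, Matrix.of_apply, Matrix.cons_val_zero,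
    Matrix.cons_val_one, Matrix.cons_val', Matrix.cons_val_fin_one] at h00 h01
  constructor <;> apply mul_left_cancel₀ hb
  · linear_combination -h01
  · linear_combination -h00

end NonsplitTorus


/-- For m = k·a(x)·k⁻¹ with x^{q+1} = 1, x ≠ ±1: m lies in SL(2,K), its centralizer in
SL(2,K) is {k·a(z)·k⁻¹ : z^{q+1} = 1}, of cardinality q + 1; hence its conjugacy class
has q(q−1) elements. -/
theorem stmt14 (q : ℕ) (hq : IsPrimePow q) (hodd : Odd q)
    (L : Type) [Field L] (K : Subfield L)
    (hcardL : Nat.card L = q ^ 2) (hcardK : Nat.card K = q)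
    (e : L) (heK : e ∈ K) (hns : ¬ ∃ s ∈ K, s ^ 2 = e)
    (et : L) (het : et ^ 2 = e)
    (k : Matrix (Fin 2) (Fin 2) L) (hk : k = !![1, -et⁻¹; et, 1])
    (x : L) (hx0 : x ≠ 0) (hx : x ^ (q + 1) = 1) (hx1 : x ≠ 1) (hx2 : x ≠ -1)
    (m : Matrix (Fin 2) (Fin 2) L) (hm : m = k * !![x, 0; 0, x⁻¹] * k⁻¹) :
    (∀ i j, m i j ∈ K) ∧ m.det = 1 ∧
    {g : Matrix (Fin 2) (Fin 2) L |
        (∀ i j, g i j ∈ K) ∧ g.det = 1 ∧ g * m = m * g} =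
      {g : Matrix (Fin 2) (Fin 2) L |
        ∃ z : L, z ≠ 0 ∧ z ^ (q + 1) = 1 ∧ g = k * !![z, 0; 0, z⁻¹] * k⁻¹} ∧
    Nat.card {g : Matrix (Fin 2) (Fin 2) L |
        (∀ i j, g i j ∈ K) ∧ g.det = 1 ∧ g * m = m * g} = q + 1 ∧
    Nat.card {n : Matrix (Fin 2) (Fin 2) L |
        ∃ g : Matrix (Fin 2) (Fin 2) L,
          (∀ i j, g i j ∈ K) ∧ g.det = 1 ∧ n = g * m * g⁻¹} = q * (q - 1) := by
  subst hk
  have hL0 : Nat.card L ≠ 0 := by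
    rw [hcardL]
    exact pow_ne_zero 2 hq.ne_zero
  have : Finite L := Nat.finite_of_card_ne_zero hL0
  have hmem (y : L) : y ∈ K ↔ y ^ q = y := by
    rw [NonsplitTorus.mem_subfield_iff_pow_card_eq K, hcardK]
  have hadd (y z : L) : (y + z) ^ q = y ^ q + z ^ q := by
    have := Fintype.ofFinite K
    have h := map_add (FiniteField.frobeniusAlgHom K L) y z
    simpa only [FiniteField.coe_frobeniusAlgHom, ← Nat.card_eq_fintype_card, hcardK] using h
  have h2 : (2 : L) ≠ 0 := by
    have := Fintype.ofFinite L
    have h := FiniteField.odd_card_of_char_ne_two (F := L)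
    intro h2
    have hchar : ringChar L = 2 := CharP.ringChar_of_prime_eq_zero Nat.prime_two h2
    have heven := FiniteField.even_card_of_char_two hchar
    rw [← Nat.card_eq_fintype_card, hcardL] at heven
    exact Nat.not_even_iff_odd.2 (hodd.pow (n := 2)) (Nat.even_iff.2 heven)
  have h2K : (2 : L) ∈ K := ofNat_mem K 2
  have ht0 : et ≠ 0 := by
    rintro rfl
    exact hns ⟨0, K.zero_mem, het⟩
  have hsub (y z : L) : (y - z) ^ q = y ^ q - z ^ q := by
    rw [sub_eq_add_neg, hadd, hodd.neg_pow, ← sub_eq_add_neg]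
  have htq : et ^ q = -et := by
    have hsq : (et ^ q) ^ 2 = et ^ 2 := by
      rw [← pow_mul, mul_comm, pow_mul, het, (hmem e).1 heK]
    refine (sq_eq_sq_iff_eq_or_eq_neg.1 hsq).resolve_left fun h => ?_
    exact hns ⟨et, (hmem et).2 h, het⟩
  have hnorm {z : L} (hz : z ^ (q + 1) = 1) : z ≠ 0 ∧ z ^ q = z⁻¹ ∧ z⁻¹ ^ q = z := by
    have hq' : z ^ q = z⁻¹ := eq_inv_of_mul_eq_one_left (by rw [← pow_succ, hz])
    refine ⟨?_, hq', by rw [inv_pow, hq', inv_inv]⟩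
    rintro rfl
    simp at hz
  have hentries {z : L} (hz : z ^ (q + 1) = 1) :
      (z + z⁻¹) / 2 ∈ K ∧ (z - z⁻¹) / (2 * et) ∈ K := by
    obtain ⟨-, hzq, hziq⟩ := hnorm hz
    constructor
    · rw [hmem, div_pow, hadd, hzq, hziq, (hmem 2).1 h2K, add_comm]
    · rw [hmem, div_pow, hsub, mul_pow, hzq, hziq, (hmem 2).1 h2K, htq, mul_neg, div_neg,
        ← neg_div, neg_sub]
  have hform (z : L) := (NonsplitTorus.conj_diag_eq ht0 h2 z).trans
    (show _ = !![(z + z⁻¹) / 2, (z - z⁻¹) / (2 * et);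
        e * ((z - z⁻¹) / (2 * et)), (z + z⁻¹) / 2] by
      congr! 3
      rw [← het]
      field_simp)
  simp only [hform] at hm ⊢
  have hK {z : L} (hz : z ^ (q + 1) = 1) : ∀ i j, !![(z + z⁻¹) / 2, (z - z⁻¹) / (2 * et);
        e * ((z - z⁻¹) / (2 * et)), (z + z⁻¹) / 2] i j ∈ K := by
    obtain ⟨h1, h3⟩ := hentries hz
    intro i j
    fin_cases i <;> fin_cases j
    exacts [h1, h3, K.mul_mem heK h3, h1]
  have hdet {z : L} (hz : z ≠ 0) : (!![(z + z⁻¹) / 2, (z - z⁻¹) / (2 * et);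
        e * ((z - z⁻¹) / (2 * et)), (z + z⁻¹) / 2] : Matrix (Fin 2) (Fin 2) L).det = 1 := by
    rw [Matrix.det_fin_two_of, ← het]
    field_simp
    ring
  have hmK : ∀ i j, m i j ∈ K := hm ▸ hK hx
  have hmdet : m.det = 1 := hm ▸ hdet hx0
  have hb : (x - x⁻¹) / (2 * et) ≠ 0 := by
    refine div_ne_zero (fun h => ?_) (mul_ne_zero h2 ht0)
    have hxx : x * x = 1 := by
      nth_rewrite 2 [sub_eq_zero.1 h]
      exact mul_inv_cancel₀ hx0
    exact (mul_self_eq_one_iff.1 hxx).elim hx1 hx2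
  have hcent : {g : Matrix (Fin 2) (Fin 2) L |
      (∀ i j, g i j ∈ K) ∧ g.det = 1 ∧ g * m = m * g} =
      {g : Matrix (Fin 2) (Fin 2) L | ∃ z : L, z ≠ 0 ∧ z ^ (q + 1) = 1 ∧
        g = !![(z + z⁻¹) / 2, (z - z⁻¹) / (2 * et);
          e * ((z - z⁻¹) / (2 * et)), (z + z⁻¹) / 2]} := by
    ext g
    constructor
    · rintro ⟨hg, hg1, hc⟩
      rw [hm] at hc
      obtain ⟨h11, h10⟩ := NonsplitTorus.eq_of_commute_of_entries hb hc
      have hprod : (g 0 0 + et * g 0 1) * (g 0 0 - et * g 0 1) = 1 := by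
        rw [Matrix.det_fin_two, h11, h10] at hg1
        rw [← hg1, ← het]
        ring
      have hinv : (g 0 0 + et * g 0 1)⁻¹ = g 0 0 - et * g 0 1 :=
        inv_eq_of_mul_eq_one_right hprod
      refine ⟨g 0 0 + et * g 0 1, left_ne_zero_of_mul_eq_one hprod, ?_, ?_⟩
      · rw [pow_succ, hadd, mul_pow, (hmem _).1 (hg 0 0), (hmem _).1 (hg 0 1), htq, ← hprod]
        ring
      · have h0 : g 0 0 = (g 0 0 + et * g 0 1 + (g 0 0 - et * g 0 1)) / 2 := by
          field_simp
          ring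
        have h1 : g 0 1 = (g 0 0 + et * g 0 1 - (g 0 0 - et * g 0 1)) / (2 * et) := by
          field_simp
          ring
        rw [hinv, ← h0, ← h1]
        nth_rewrite 1 [Matrix.eta_fin_two g]
        rw [h11, h10]
    · rintro ⟨z, hz0, hz, rfl⟩
      refine ⟨hK hz, hdet hz0, ?_⟩
      rw [hm, Matrix.mul_fin_two, Matrix.mul_fin_two]
      congr! 3 <;> ring_nf
  have hcentcard : Nat.card {g : Matrix (Fin 2) (Fin 2) L |
      (∀ i j, g i j ∈ K) ∧ g.det = 1 ∧ g * m = m * g} = q + 1 := by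
    rw [hcent]
    refine Eq.trans (Eq.symm ?_) (NonsplitTorus.nat_card_norm_one hcardL)
    refine Nat.card_eq_of_bijective (fun z => ⟨_, z.1, (hnorm z.2).1, z.2, rfl⟩)
      ⟨fun y z hyz => Subtype.ext ?_, ?_⟩
    · have h00 := congrFun (congrFun (congrArg Subtype.val hyz) 0) 0
      have h01 := congrFun (congrFun (congrArg Subtype.val hyz) 0) 1
      change (y.1 + y.1⁻¹) / 2 = (z.1 + z.1⁻¹) / 2 at h00
      change (y.1 - y.1⁻¹) / (2 * et) = (z.1 - z.1⁻¹) / (2 * et) at h01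
      rw [div_left_inj' h2] at h00
      rw [div_left_inj' (mul_ne_zero h2 ht0)] at h01
      apply mul_left_cancel₀ h2
      linear_combination h00 + h01
    · rintro ⟨_, z, -, hz, rfl⟩
      exact ⟨⟨z, hz⟩, rfl⟩
  refine ⟨hmK, hmdet, hcent, hcentcard, ?_⟩
  have horbit := NonsplitTorus.nat_card_conjugates_mul_nat_card_centralizer K m hmK hmdet
  rw [hcentcard, NonsplitTorus.nat_card_SL_two, hcardK] at horbit
  exact Nat.eq_of_mul_eq_mul_right (Nat.succ_pos q) horbit
end

section
/- Let x ∈ SL(2, K). If (tr x)² − 4 is a non-square in K (in particular nonzero), then x is conjugate in SL(2, K) to k·a(z)·k⁻¹ for some z ∈ L^× with z^{q+1} = 1, z ≠ 1 and z ≠ −1 (and k·a(z)·k⁻¹ has all entries in K). -/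
/-- Over a finite field of odd characteristic, a nondegenerate diagonal binary quadratic form
represents every element. -/
lemma FiniteField.exists_mul_sq_add_mul_sq {F : Type*} [Field F] [Finite F]
    (hF : Odd (Nat.card F)) {a b : F} (ha : a ≠ 0) (hb : b ≠ 0) (s : F) :
    ∃ u w : F, a * u ^ 2 + b * w ^ 2 = s := by
  classical
  have := Fintype.ofFinite F
  rw [Nat.card_eq_fintype_card] at hF
  obtain ⟨u, w, h⟩ := FiniteField.exists_root_sum_quadratic
    (f := Polynomial.C a * Polynomial.X ^ 2 + Polynomial.C 0 * Polynomial.X + Polynomial.C (-s))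
    (g := Polynomial.C b * Polynomial.X ^ 2 + Polynomial.C 0 * Polynomial.X + Polynomial.C 0)
    (Polynomial.degree_quadratic ha) (Polynomial.degree_quadratic hb) (Nat.odd_iff.mp hF)
  refine ⟨u, w, ?_⟩
  simp at h
  linear_combination h

/-- The product of two non-squares in a finite field is a square. -/
lemma FiniteField.isSquare_mul_of_not_isSquare {F : Type*} [Field F] [Finite F]
    {a b : F} (ha : ¬ IsSquare a) (hb : ¬ IsSquare b) : IsSquare (a * b) := by
  classical
  have := Fintype.ofFinite F
  have ha0 : a ≠ 0 := by rintro rfl; exact ha (IsSquare.zero)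
  have hb0 : b ≠ 0 := by rintro rfl; exact hb (IsSquare.zero)
  rw [← quadraticChar_one_iff_isSquare (mul_ne_zero ha0 hb0), map_mul,
    quadraticChar_neg_one_iff_not_isSquare.mpr ha, quadraticChar_neg_one_iff_not_isSquare.mpr hb]
  norm_num

/-- A square root of a non-square of `F` is negated by the Frobenius over `F`. -/
lemma FiniteField.pow_card_eq_neg_of_sq_eq {F E : Type*} [Field F] [Finite F] [Field E]
    [Algebra F E] (hF : Odd (Nat.card F)) {a : F} (ha : ¬ IsSquare a) {r : E}
    (hr : r ^ 2 = algebraMap F E a) : r ^ Nat.card F = -r := by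
  classical
  have := Fintype.ofFinite F
  rw [Nat.card_eq_fintype_card] at hF ⊢
  have hchar : ringChar F ≠ 2 := by
    intro h
    have := FiniteField.even_card_of_char_two h
    have := Nat.odd_iff.mp hF
    omega
  have ha0 : a ≠ 0 := by rintro rfl; exact ha (IsSquare.zero)
  have h1 : a ^ (Fintype.card F / 2) = -1 :=
    (FiniteField.pow_dichotomy hchar ha0).resolve_left
      fun h => ha ((FiniteField.isSquare_iff hchar ha0).mpr h)
  have h2 : Fintype.card F = 2 * (Fintype.card F / 2) + 1 := by
    have := Nat.odd_iff.mp hF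
    omega
  rw [h2, pow_succ, pow_mul, hr, ← map_pow, h1]
  simp

/-- Over a finite field of odd characteristic, an element of `SL₂` with trace `t`, where
`t ^ 2 - 4 = 4 * e * s ^ 2` is not a square, is conjugate in `SL₂` to `!![t / 2, s; e * s, t / 2]`. -/
lemma FiniteField.exists_sl_two_conj {F : Type*} [Field F] [Finite F]
    (hF : Odd (Nat.card F)) (h2 : (2 : F) ≠ 0) {a b c d e s : F} (hdet : a * d - b * c = 1)
    (hD : ¬ IsSquare ((a + d) ^ 2 - 4)) (hs : s ≠ 0) (hes : (a + d) ^ 2 - 4 = 4 * e * s ^ 2) :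
    ∃ g : Matrix (Fin 2) (Fin 2) F, g.det = 1 ∧
      g * !![a, b; c, d] = !![(a + d) / 2, s; e * s, (a + d) / 2] * g := by
  have hc : c ≠ 0 := by
    rintro rfl
    exact hD ⟨a - d, by linear_combination 4 * hdet⟩
  have hD0 : (a + d) ^ 2 - 4 ≠ 0 := by
    intro h
    exact hD (h ▸ IsSquare.zero)
  have h4 : (4 : F) ≠ 0 := by
    have : (4 : F) = 2 * 2 := by norm_num
    rw [this]
    exact mul_ne_zero h2 h2
  obtain ⟨u, w, h⟩ := FiniteField.exists_mul_sq_add_mul_sq hF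
    (div_ne_zero hD0 (mul_ne_zero h4 hc)) (neg_ne_zero.mpr hc) s
  obtain ⟨v, rfl⟩ : ∃ v, w = v + (a - d) * u / (2 * c) := ⟨w - (a - d) * u / (2 * c), by ring⟩
  have hform : b * u ^ 2 - (a - d) * u * v - c * v ^ 2 = s := by
    rw [← h]
    field_simp
    linear_combination (-16 * u ^ 2) * hdet
  refine ⟨!![u, v; (u * (a - d) / 2 + v * c) / s, (u * b - v * (a - d) / 2) / s], ?_, ?_⟩
  · rw [Matrix.det_fin_two_of]
    field_simp
    linear_combination 2 * hform
  · ext i j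
    fin_cases i <;> fin_cases j <;> simp [Matrix.mul_apply, Fin.sum_univ_two] <;> field_simp
    · ring
    · ring
    · linear_combination u * hes - 4 * u * hdet
    · linear_combination v * hes - 4 * v * hdet


/-- If (tr x)² − 4 is a non-square in K, then x is conjugate in SL(2,K) to
k·a(z)·k⁻¹ for some z with z^{q+1} = 1, z ≠ ±1 (and k·a(z)·k⁻¹ has entries in K). -/
theorem stmt18 (q : ℕ) (hq : IsPrimePow q) (hodd : Odd q)
    (L : Type) [Field L] (K : Subfield L)
    (hcardL : Nat.card L = q ^ 2) (hcardK : Nat.card K = q)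
    (e : L) (heK : e ∈ K) (hns : ¬ ∃ s ∈ K, s ^ 2 = e)
    (et : L) (het : et ^ 2 = e)
    (k : Matrix (Fin 2) (Fin 2) L) (hk : k = !![1, -et⁻¹; et, 1])
    (x : Matrix (Fin 2) (Fin 2) L) (hxK : ∀ i j, x i j ∈ K) (hx : x.det = 1)
    (hnsq : ¬ ∃ s ∈ K, s ^ 2 = x.trace ^ 2 - 4) :
    ∃ z : L, z ≠ 0 ∧ z ^ (q + 1) = 1 ∧ z ≠ 1 ∧ z ≠ -1 ∧
      (∀ i j, (k * !![z, 0; 0, z⁻¹] * k⁻¹) i j ∈ K) ∧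
      ∃ g : Matrix (Fin 2) (Fin 2) L, (∀ i j, g i j ∈ K) ∧ g.det = 1 ∧
        g * x * g⁻¹ = k * !![z, 0; 0, z⁻¹] * k⁻¹ := by
  subst hk
  have hKfin : Finite K := Nat.finite_of_card_ne_zero (by rw [hcardK]; exact hq.ne_zero)
  have hKodd : Odd (Nat.card K) := hcardK ▸ hodd
  have hsq (a : K) (h : ¬ ∃ s ∈ K, s ^ 2 = (a : L)) : ¬ IsSquare a := by
    rintro ⟨r, rfl⟩
    exact h ⟨r, r.2, by push_cast; ring⟩
  have coe_two : ((2 : K) : L) = 2 := rfl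
  have coe_four : ((4 : K) : L) = 4 := rfl
  have algebraMap_coe (y : K) : algebraMap K L y = y := rfl
  obtain ⟨e, rfl⟩ : ∃ e' : K, (e' : L) = e := ⟨⟨e, heK⟩, rfl⟩
  choose x' hx' using fun i j => (⟨⟨x i j, hxK i j⟩, rfl⟩ : ∃ y : K, (y : L) = x i j)
  obtain ⟨a, ha⟩ : ∃ a, x' 0 0 = a := ⟨_, rfl⟩
  obtain ⟨b, hb⟩ : ∃ b, x' 0 1 = b := ⟨_, rfl⟩
  obtain ⟨c, hc⟩ : ∃ c, x' 1 0 = c := ⟨_, rfl⟩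
  obtain ⟨d, hd⟩ : ∃ d, x' 1 1 = d := ⟨_, rfl⟩
  have hxe : x = (!![a, b; c, d] : Matrix (Fin 2) (Fin 2) K).map K.subtype := by
    ext i j
    fin_cases i <;> fin_cases j <;> simp [← ha, ← hb, ← hc, ← hd, hx']
  subst hxe
  have hdet : a * d - b * c = 1 := by
    rw [Matrix.det_fin_two] at hx
    simp at hx
    exact_mod_cast hx
  have hD : ¬ IsSquare ((a + d) ^ 2 - 4) := hsq _ (by simpa [Matrix.trace_fin_two, coe_four] using hnsq)
  have he := hsq e hns
  have he0 : e ≠ 0 := by rintro rfl; exact he IsSquare.zero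
  have h2 : (2 : K) ≠ 0 := by
    intro h
    have hch : ringChar K = 2 := by
      have : CharP K 2 := CharTwo.of_one_ne_zero_of_two_eq_zero one_ne_zero h
      exact ringChar.eq K 2 ▸ rfl
    have := Fintype.ofFinite K
    have h3 := FiniteField.even_card_of_char_two hch
    rw [Nat.card_eq_fintype_card, Nat.odd_iff] at hKodd
    omega
  obtain ⟨r, hr⟩ := FiniteField.isSquare_mul_of_not_isSquare he hD
  obtain ⟨s, hsr⟩ : ∃ s, s = r / (2 * e) := ⟨_, rfl⟩
  have hes : (a + d) ^ 2 - 4 = 4 * e * s ^ 2 := by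
    rw [hsr]
    field_simp
    linear_combination 4 * hr
  have hs : s ≠ 0 := by
    rintro rfl
    exact hD (by rw [hes]; simp)
  obtain ⟨g, hg, hgx⟩ := FiniteField.exists_sl_two_conj hKodd h2 hdet hD hs hes
  have het0 : et ≠ 0 := by
    rintro rfl
    exact he0 (by exact_mod_cast (show (e : L) = 0 by rw [← het]; simp))
  have h2L : (2 : L) ≠ 0 := by
    rw [← coe_two]
    exact_mod_cast h2
  have hsL : (s : L) ≠ 0 := by simpa using hs
  have hesL : ((a : L) + d) ^ 2 - 4 = 4 * et ^ 2 * (s : L) ^ 2 := by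
    rw [het]
    simpa [coe_four] using congrArg (Subtype.val : K → L) hes
  obtain ⟨z, hz⟩ : ∃ z : L, z = ((a : L) + d) / 2 + et * s := ⟨_, rfl⟩
  have hzz : z * (((a : L) + d) / 2 - et * s) = 1 := by
    rw [hz]
    field_simp
    linear_combination hesL
  have hz0 : z ≠ 0 := left_ne_zero_of_mul_eq_one hzz
  have hzi : z⁻¹ = ((a : L) + d) / 2 - et * s := inv_eq_of_mul_eq_one_right hzz
  have hzq : z ^ q = ((a : L) + d) / 2 - et * s := by
    have := Fintype.ofFinite K
    have h1 := FiniteField.pow_card_eq_neg_of_sq_eq (E := L) hKodd he het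
    have h3 (y : L) : FiniteField.frobeniusAlgHom K L y = y ^ q := by
      rw [FiniteField.coe_frobeniusAlgHom, ← Nat.card_eq_fintype_card, hcardK]
    have h4 : z = algebraMap K L ((a + d) / 2) + et * algebraMap K L s := by
      rw [hz]
      simp only [algebraMap_coe, Subfield.coe_div, Subfield.coe_add, coe_two]
    rw [← h3, h4, map_add, map_mul, AlgHom.commutes, AlgHom.commutes, h3, ← hcardK, h1]
    simp only [algebraMap_coe, Subfield.coe_div, Subfield.coe_add, coe_two]
    ring
  have hne : z ≠ z⁻¹ := by
    rw [hzi, hz]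
    intro h
    exact mul_ne_zero (mul_ne_zero h2L het0) hsL (by linear_combination h)
  have hconj : (!![1, -et⁻¹; et, 1] * !![z, 0; 0, z⁻¹] * (!![1, -et⁻¹; et, 1])⁻¹ :
      Matrix (Fin 2) (Fin 2) L) =
      (!![(a + d) / 2, s; e * s, (a + d) / 2] : Matrix (Fin 2) (Fin 2) K).map K.subtype := by
    have hkdet : (!![1, -et⁻¹; et, 1] : Matrix (Fin 2) (Fin 2) L).det = 2 := by
      rw [Matrix.det_fin_two_of]
      field_simp
      norm_num
    have hu : IsUnit (!![1, -et⁻¹; et, 1] : Matrix (Fin 2) (Fin 2) L).det := by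
      rw [hkdet]
      exact h2L.isUnit
    rw [← Matrix.mul_nonsing_inv_cancel_right (A := !![1, -et⁻¹; et, 1])
      (B := (!![(a + d) / 2, s; e * s, (a + d) / 2] : Matrix (Fin 2) (Fin 2) K).map K.subtype) hu]
    congr 1
    rw [hzi, hz]
    ext i j
    fin_cases i <;> fin_cases j <;>
      simp [Matrix.mul_apply, Fin.sum_univ_two, coe_two, ← het] <;> field_simp <;> ring
  refine ⟨z, hz0, ?_, ?_, ?_, ?_, g.map K.subtype, fun i j => (g i j).2, ?_, ?_⟩
  · rw [pow_succ, hzq, mul_comm, hzz]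
  · rintro rfl
    simp at hne
  · rintro rfl
    simp [inv_neg] at hne
  · intro i j
    rw [hconj]
    exact Subtype.property _
  · rw [← RingHom.mapMatrix_apply, ← RingHom.map_det, hg, map_one]
  · rw [hconj]
    have hu : IsUnit (g.map K.subtype).det := by
      rw [← RingHom.mapMatrix_apply, ← RingHom.map_det, hg, map_one]
      exact isUnit_one
    rw [← Matrix.map_mul, hgx, Matrix.map_mul, Matrix.mul_nonsing_inv_cancel_right _ _ hu]
end

section
/- Let q be an odd prime power, K a finite field with q elements, and e a non-square element of K^×. If x ∈ SL(2, K) satisfies tr x = 2 and x ≠ 1, then x is conjugate in SL(2, K) to exactly one of b(1) and b(e); in particular b(1) and b(e) are not conjugate in SL(2, K). -/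
theorem Matrix.conj_eq_iff_mul_eq_mul {n K : Type*} [Fintype n] [DecidableEq n] [CommRing K]
    {g : Matrix n n K} (hg : g.det = 1) (x z : Matrix n n K) :
    g * x * g⁻¹ = z ↔ g * x = z * g := by
  have hu : IsUnit g.det := by simp [hg]
  constructor
  · rintro rfl
    rw [Matrix.nonsing_inv_mul_cancel_right _ _ hu]
  · intro h
    rw [h, Matrix.mul_nonsing_inv_cancel_right _ _ hu]

/-- In a finite field of odd order, every nonzero element lies in the square class of `1` or in that
of a given non-square. -/
theorem FiniteField.exists_eq_sq_or_eq_mul_sq {K : Type*} [Field K] [Finite K]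
    (hodd : Odd (Nat.card K)) {e u : K} (he : e ≠ 0) (hns : ¬ ∃ s : K, s ^ 2 = e) (hu : u ≠ 0) :
    (∃ k : K, u = k ^ 2) ∨ ∃ k : K, u = e * k ^ 2 := by
  classical
  have := Fintype.ofFinite K
  have h2 : ringChar K ≠ 2 := fun h => by
    rw [Nat.card_eq_fintype_card] at hodd
    have := FiniteField.even_card_of_char_two h
    rw [Nat.odd_iff] at hodd
    omega
  by_cases hus : IsSquare u
  · exact Or.inl (hus.imp fun k hk => by rw [hk, sq])
  have hes : ¬ IsSquare e := fun ⟨s, hs⟩ => hns ⟨s, by rw [hs, sq]⟩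
  have hχ : quadraticChar K (u * e) = 1 := by
    rw [map_mul, quadraticChar_neg_one_iff_not_isSquare.2 hus,
      quadraticChar_neg_one_iff_not_isSquare.2 hes]
    norm_num
  obtain ⟨w, hw⟩ := (quadraticChar_one_iff_isSquare (mul_ne_zero hu he)).1 hχ
  refine Or.inr ⟨w / e, ?_⟩
  field_simp
  rw [hw, sq]

/-- A non-identity matrix of determinant 1 and trace 2 determines a nonzero scalar `u` such that it
is conjugate to `b(y)` whenever `u` and `y` are in the same square class. -/
theorem Matrix.exists_conj_unitriangular {K : Type*} [Field K] (x : Matrix (Fin 2) (Fin 2) K)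
    (hx : x.det = 1) (htr : x.trace = 2) (hx1 : x ≠ 1) :
    ∃ u : K, u ≠ 0 ∧ ∀ y k : K, u = y * k ^ 2 →
      ∃ g : Matrix (Fin 2) (Fin 2) K, g.det = 1 ∧ g * x * g⁻¹ = !![1, y; 0, 1] := by
  obtain ⟨a, b, c, d, rfl⟩ : ∃ a b c d, x = !![a, b; c, d] := ⟨_, _, _, _, Matrix.eta_fin_two x⟩
  rw [Matrix.det_fin_two_of] at hx
  rw [Matrix.trace_fin_two_of] at htr
  obtain rfl : d = 2 - a := by linear_combination htr
  by_cases hc : c = 0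
  · subst hc
    obtain rfl : a = 1 := by
      have h : (a - 1) ^ 2 = 0 := by linear_combination -hx
      linear_combination pow_eq_zero_iff two_ne_zero |>.1 h
    have hb : b ≠ 0 := by
      rintro rfl
      refine hx1 ?_
      rw [Matrix.one_fin_two]
      norm_num
    refine ⟨b, hb, fun y k h => ?_⟩
    have hk : k ≠ 0 := by rintro rfl; simp [h] at hb
    have hg : (!![k⁻¹, 0; 0, k]).det = 1 := by simp [hk]
    refine ⟨_, hg, (Matrix.conj_eq_iff_mul_eq_mul hg _ _).2 ?_⟩
    ext i j
    fin_cases i <;> fin_cases j <;> simp [Matrix.mul_apply, Fin.sum_univ_two, h]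
    · field_simp
    · ring
  · refine ⟨-c, neg_ne_zero.2 hc, fun y k h => ?_⟩
    have hk : k ≠ 0 := by rintro rfl; simp [hc] at h
    have hg : (!![0, k⁻¹; -k, k * (a - 1) / c]).det = 1 := by simp [hk]
    refine ⟨_, hg, (Matrix.conj_eq_iff_mul_eq_mul hg _ _).2 ?_⟩
    ext i j
    fin_cases i <;> fin_cases j <;> simp [Matrix.mul_apply, Fin.sum_univ_two]
    · field_simp
      linear_combination -h
    · field_simp
      linear_combination (a - 1) * h
    · field_simp
      ring
    · field_simp
      linear_combination hx

theorem Matrix.not_conj_unitriangular_one {K : Type*} [Field K] {e : K}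
    (hns : ¬ ∃ s : K, s ^ 2 = e) :
    ¬ ∃ g : Matrix (Fin 2) (Fin 2) K, g.det = 1 ∧
      g * !![1, 1; 0, 1] * g⁻¹ = !![1, e; 0, 1] := by
  rintro ⟨g, hg, h⟩
  rw [Matrix.conj_eq_iff_mul_eq_mul hg] at h
  rw [Matrix.det_fin_two] at hg
  have h01 := congrFun (congrFun h 0) 1
  have h11 := congrFun (congrFun h 1) 1
  simp only [Matrix.mul_apply, Fin.sum_univ_two, Matrix.of_apply, Matrix.cons_val', Matrix.cons_val,
    Matrix.cons_val_fin_one] at h01 h11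
  have hs : g 1 0 = 0 := by linear_combination h11
  have hp : g 0 0 = e * g 1 1 := by linear_combination h01
  rw [hs, hp] at hg
  refine hns ⟨e * g 1 1, ?_⟩
  linear_combination e * hg

/-- A non-identity element of SL(2,K) of trace 2 is conjugate to exactly one of b(1)
and b(e), where e is a non-square; in particular b(1) and b(e) are not conjugate. -/
theorem stmt19 (q : ℕ) (hq : IsPrimePow q) (hodd : Odd q)
    (K : Type) [Field K] (hcard : Nat.card K = q)
    (e : K) (he : e ≠ 0) (hns : ¬ ∃ s : K, s ^ 2 = e)
    (x : Matrix (Fin 2) (Fin 2) K) (hx : x.det = 1)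
    (htr : x.trace = 2) (hx1 : x ≠ 1) :
    Xor'
      (∃ g : Matrix (Fin 2) (Fin 2) K, g.det = 1 ∧ g * x * g⁻¹ = !![1, 1; 0, 1])
      (∃ g : Matrix (Fin 2) (Fin 2) K, g.det = 1 ∧ g * x * g⁻¹ = !![1, e; 0, 1]) ∧
    ¬ ∃ g : Matrix (Fin 2) (Fin 2) K, g.det = 1 ∧
        g * !![1, 1; 0, 1] * g⁻¹ = !![1, e; 0, 1] := by
  have : Finite K := Nat.finite_of_card_ne_zero (hcard ▸ hq.ne_zero)
  have hnot := Matrix.not_conj_unitriangular_one hns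
  refine ⟨xor_iff_or_and_not_and _ _ |>.2 ⟨?_, ?_⟩, hnot⟩
  · obtain ⟨u, hu, h⟩ := Matrix.exists_conj_unitriangular x hx htr hx1
    refine (FiniteField.exists_eq_sq_or_eq_mul_sq (hcard ▸ hodd) he hns hu).imp ?_ ?_
    · rintro ⟨k, hk⟩
      exact h 1 k (by rw [hk, one_mul])
    · rintro ⟨k, hk⟩
      exact h e k hk
  · rintro ⟨⟨g, hg, h1⟩, g', hg', h2⟩
    have hgu : IsUnit g.det := by simp [hg]
    have hdet : (g' * g⁻¹).det = 1 := by simp [Matrix.det_nonsing_inv, hg, hg']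
    refine hnot ⟨g' * g⁻¹, hdet, (Matrix.conj_eq_iff_mul_eq_mul hdet _ _).2 ?_⟩
    have hgu' : IsUnit g'.det := by simp [hg']
    simp only [← h1, ← h2, mul_assoc, Matrix.nonsing_inv_mul_cancel_left _ _ hgu,
      Matrix.nonsing_inv_mul_cancel_left _ _ hgu']
end
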